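/- arXiv:1406.7798 — 2 statements merged into one kernel-verified Lean document; each statement's English description precedes it below -/
import Mathlib

section
/- Let μ ∈ (0,1], k ∈ ℕ, and τ ∈ ℝ with |λτ/(4μk)| ≤ 1/√2. Then 0 ≤ 1 − (ϑ̂((μk)^{−1}τ))^k ≤ λ²τ²/(8μ²k). -/
open MeasureTheory Real Filter Topology

noncomputable section

/-- `ψ(t) = (1 + cos πt)/2` for `|t| ≤ 1`, `ψ(t) = 0` for `|t| > 1` -/
def psi (t : ℝ) : ℝ := if |t| ≤ 1 then (1 + Real.cos (Real.pi * t)) / 2 else 0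

/-- the Fourier transform `f̂(τ) = ∫ f(t) e^{-iτt} dt` -/
def FT (f : ℝ → ℝ) (τ : ℝ) : ℂ := ∫ t : ℝ, (f t : ℂ) * Complex.exp (-(Complex.I * τ * t))

/-- the cosine transform `∫ f(t) cos(τt) dt` (equal to the Fourier transform for
even real functions) -/
def FTc (f : ℝ → ℝ) (τ : ℝ) : ℝ := ∫ t : ℝ, f t * Real.cos (τ * t)

/-- `ϑ(t) = 4λ⁻¹ ψ(4λ⁻¹ t)` -/
def theta (lam t : ℝ) : ℝ := 4 * lam⁻¹ * psi (4 * lam⁻¹ * t)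

theorem psi_nonneg (t : ℝ) : 0 ≤ psi t := by
  unfold psi
  split_ifs
  · linarith [Real.neg_one_le_cos (Real.pi * t)]
  · exact le_rfl

theorem psi_eq_indicator :
    psi = (Set.Icc (-1 : ℝ) 1).indicator fun t => (1 + Real.cos (Real.pi * t)) / 2 := by
  ext t
  simp only [psi, Set.indicator, Set.mem_Icc, abs_le]

theorem integrable_psi : Integrable psi := by
  rw [psi_eq_indicator, integrable_indicator_iff measurableSet_Icc]
  exact Continuous.integrableOn_Icc (by fun_prop)

theorem integral_psi : ∫ t, psi t = 1 := by
  have hcos : ∫ t in (-1 : ℝ)..1, Real.cos (Real.pi * t) = 0 := by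
    rw [intervalIntegral.integral_comp_mul_left _ Real.pi_ne_zero]
    simp
  rw [psi_eq_indicator, integral_indicator measurableSet_Icc, integral_Icc_eq_integral_Ioc,
    ← intervalIntegral.integral_of_le (by norm_num), intervalIntegral.integral_div,
    intervalIntegral.integral_add (by simp) (Continuous.intervalIntegrable (by fun_prop) _ _),
    hcos]
  norm_num

theorem integrable_psi_mul_cos (x : ℝ) : Integrable fun t => psi t * Real.cos (x * t) :=
  integrable_psi.mul_bdd (c := 1) (Continuous.aestronglyMeasurable (by fun_prop))
    (ae_of_all _ fun t => by simpa using Real.abs_cos_le_one (x * t))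

theorem FTc_psi_le_one (x : ℝ) : FTc psi x ≤ 1 := by
  rw [← integral_psi]
  exact integral_mono (integrable_psi_mul_cos x) integrable_psi fun t =>
    mul_le_of_le_one_right (psi_nonneg t) (Real.cos_le_one _)

theorem one_sub_sq_div_two_le_FTc_psi (x : ℝ) : 1 - x ^ 2 / 2 ≤ FTc psi x := by
  have h : ∫ t, psi t * (1 - x ^ 2 / 2) = 1 - x ^ 2 / 2 := by
    rw [integral_mul_const, integral_psi, one_mul]
  rw [← h]
  refine integral_mono (integrable_psi.mul_const _) (integrable_psi_mul_cos x) fun t => ?_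
  by_cases ht : |t| ≤ 1
  · refine mul_le_mul_of_nonneg_left ?_ (psi_nonneg t)
    have ht2 : t ^ 2 ≤ 1 := (sq_le_one_iff_abs_le_one t).2 ht
    nlinarith [Real.one_sub_sq_div_two_le_cos (x := x * t), sq_nonneg x]
  · simp [psi, ht]

theorem FTc_theta {lam : ℝ} (hlam : 0 < lam) (τ : ℝ) :
    FTc (theta lam) τ = FTc psi (lam * τ / 4) := by
  have h := Measure.integral_comp_mul_left
    (fun s => psi s * Real.cos (lam * τ / 4 * s)) (4 * lam⁻¹)
  have hpos : 0 < 4 * lam⁻¹ := by positivity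
  rw [abs_of_pos (inv_pos.2 hpos), smul_eq_mul, eq_inv_mul_iff_mul_eq₀ hpos.ne',
    ← integral_const_mul] at h
  unfold FTc
  rw [← h]
  congr 1 with t
  have harg : lam * τ / 4 * (4 * lam⁻¹ * t) = τ * t := by field_simp
  rw [harg, theta, mul_assoc (4 * lam⁻¹)]

/-- For `μ ∈ (0,1]`, `k ∈ ℕ`, and `|λτ/(4μk)| ≤ 1/√2`:
`0 ≤ 1 − (ϑ̂((μk)⁻¹τ))^k ≤ λ²τ²/(8μ²k)`. -/
theorem thetahat_power_estimate :
    ∀ lam : ℝ, lam ∈ Set.Ioc (0:ℝ) 1 →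
    ∀ μ : ℝ, μ ∈ Set.Ioc (0:ℝ) 1 →
    ∀ k : ℕ, 1 ≤ k →
    ∀ τ : ℝ, |lam * τ / (4 * μ * k)| ≤ 1 / Real.sqrt 2 →
      0 ≤ 1 - (FTc (theta lam) ((μ * k)⁻¹ * τ))^k ∧
      1 - (FTc (theta lam) ((μ * k)⁻¹ * τ))^k ≤ lam^2 * τ^2 / (8 * μ^2 * k) := by
  intro lam hlam μ hμ k hk τ hτ
  have hμ0 : 0 < μ := hμ.1
  have hk0 : (0 : ℝ) < k := by exact_mod_cast hk
  have hx : lam * ((μ * k)⁻¹ * τ) / 4 = lam * τ / (4 * μ * k) := by field_simp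
  rw [FTc_theta hlam.1, hx]
  set x := lam * τ / (4 * μ * k) with hxdef
  have hx2 : x ^ 2 ≤ 1 / 2 := by
    have h := pow_le_pow_left₀ (abs_nonneg x) hτ 2
    rwa [sq_abs, div_pow 1, one_pow, Real.sq_sqrt (by norm_num)] at h
  have hlow := one_sub_sq_div_two_le_FTc_psi x
  have hnonneg : 0 ≤ FTc psi x := by linarith
  refine ⟨sub_nonneg.2 (pow_le_one₀ hnonneg (FTc_psi_le_one x)), ?_⟩
  have hbern := one_add_mul_sub_le_pow (show -1 ≤ FTc psi x by linarith) k
  have hrhs : lam ^ 2 * τ ^ 2 / (8 * μ ^ 2 * k) = 2 * (k * x ^ 2) := by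
    rw [hxdef]
    field_simp
    ring
  rw [hrhs]
  nlinarith [mul_le_mul_of_nonneg_left hlow hk0.le, mul_nonneg hk0.le (sq_nonneg x)]
end
end

section
/- Let μ ∈ (0,1] and k ∈ ℕ with μ²k^{3/5} ≥ 1, and define φ_μ(t) = μ^{−1}ϑ(μ^{−1}t) and φ_{μ,k} = ϑ_k ∗ φ_μ. Then ‖φ_μ − φ_{μ,k}‖_{L²(ℝ)} ≤ C (k^{3/5}μ²)^{−5/8}, where C depends only on λ. -/
open MeasureTheory Real Filter Topology

noncomputable section

/-- the convolution `(f ∗ g)(t) = ∫ f(t-s) g(s) ds` -/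
def conv (f g : ℝ → ℝ) (t : ℝ) : ℝ := ∫ s : ℝ, f (t - s) * g s

/-- `iterConv f k = f^{∗(k+1)}`: the (k+1)-fold self-convolution of f -/
def iterConv (f : ℝ → ℝ) : ℕ → (ℝ → ℝ)
  | 0 => f
  | (k+1) => conv f (iterConv f k)

/-- `ϑ_k(t) = (kϑ(kt))^{∗(k)}` -/
def thetak (lam : ℝ) (k : ℕ) : ℝ → ℝ :=
  iterConv (fun t => (k : ℝ) * theta lam ((k : ℝ) * t)) (k - 1)

/-- `φ_μ(t) = μ⁻¹ ϑ(μ⁻¹ t)` -/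
def phimu (lam μ t : ℝ) : ℝ := μ⁻¹ * theta lam (μ⁻¹ * t)

/-- `φ_{μ,k} = ϑ_k ∗ φ_μ` -/
def phimuk (lam μ : ℝ) (k : ℕ) : ℝ → ℝ := conv (thetak lam k) (phimu lam μ)

/-- A continuous, compactly supported, centred probability density on `ℝ` with variance `v`. -/
structure IsCentredDensity (f : ℝ → ℝ) (v : ℝ) : Prop where
  continuous : Continuous f
  hasCompactSupport : HasCompactSupport f
  nonneg : ∀ t, 0 ≤ f t
  integral_eq_one : ∫ t, f t = 1
  integral_mul_eq_zero : ∫ t, t * f t = 0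
  integral_sq_mul_eq : ∫ t, t ^ 2 * f t = v

theorem conv_eq_convolution (f g : ℝ → ℝ) :
    conv f g = convolution f g (ContinuousLinearMap.mul ℝ ℝ) volume := by
  ext t
  exact convolution_mul_swap.symm

theorem continuous_conv {f g : ℝ → ℝ} (hf : Continuous f) (hfs : HasCompactSupport f)
    (hg : Continuous g) : Continuous (conv f g) := by
  rw [conv_eq_convolution]
  exact hfs.continuous_convolution_left _ hf hg.locallyIntegrable

theorem hasCompactSupport_conv {f g : ℝ → ℝ} (hfs : HasCompactSupport f)
    (hgs : HasCompactSupport g) : HasCompactSupport (conv f g) := by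
  rw [conv_eq_convolution]
  exact hfs.convolution _ hgs

theorem integral_conv {f g : ℝ → ℝ} (hf : Integrable f) (hg : Integrable g) :
    ∫ t, conv f g t = (∫ t, f t) * ∫ t, g t := by
  rw [conv_eq_convolution]
  exact integral_convolution (ContinuousLinearMap.mul ℝ ℝ) hf hg

theorem integrable_conv_integrand {f g : ℝ → ℝ} (hf : Continuous f) (hg : Continuous g)
    (hgs : HasCompactSupport g) (t : ℝ) : Integrable fun s => f (t - s) * g s :=
  (by fun_prop : Continuous fun s => f (t - s) * g s).integrable_of_hasCompactSupport
    hgs.mul_left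

/-- Multiplication by the variable is a derivation for the convolution product. -/
theorem mul_conv {f g : ℝ → ℝ} (hf : Continuous f) (hg : Continuous g)
    (hgs : HasCompactSupport g) (t : ℝ) :
    t * conv f g t = conv (fun s => s * f s) g t + conv f (fun s => s * g s) t := by
  unfold conv
  rw [← integral_const_mul, ← integral_add
    (integrable_conv_integrand (f := fun s => s * f s) (by fun_prop) hg hgs t)
    (integrable_conv_integrand (g := fun s => s * g s) hf (by fun_prop) hgs.mul_left t)]
  congr with s
  ring

theorem sq_mul_conv {f g : ℝ → ℝ} (hf : Continuous f) (hg : Continuous g)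
    (hgs : HasCompactSupport g) (t : ℝ) :
    t ^ 2 * conv f g t = conv (fun s => s ^ 2 * f s) g t
      + 2 * conv (fun s => s * f s) (fun s => s * g s) t + conv f (fun s => s ^ 2 * g s) t := by
  have h : ∀ u : ℝ → ℝ, (fun s => s * (s * u s)) = fun s => s ^ 2 * u s := fun u => by
    ext s; ring
  rw [pow_two, mul_assoc, mul_conv hf hg hgs, mul_add,
    mul_conv (f := fun s => s * f s) (by fun_prop) hg hgs,
    mul_conv (g := fun s => s * g s) hf (by fun_prop) hgs.mul_left, h, h]
  ring

theorem IsCentredDensity.conv {f g : ℝ → ℝ} {v w : ℝ} (hf : IsCentredDensity f v)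
    (hg : IsCentredDensity g w) : IsCentredDensity (conv f g) (v + w) := by
  obtain ⟨fc, fs, f0, f1, fm, fv⟩ := hf
  obtain ⟨gc, gs, g0, g1, gm, gv⟩ := hg
  have int : ∀ {u : ℝ → ℝ}, Continuous u → HasCompactSupport u → Integrable u :=
    fun h h' => h.integrable_of_hasCompactSupport h'
  have fc1 : Continuous fun s => s * f s := by fun_prop
  have fc2 : Continuous fun s => s ^ 2 * f s := by fun_prop
  have gc1 : Continuous fun s => s * g s := by fun_prop
  have gc2 : Continuous fun s => s ^ 2 * g s := by fun_prop
  have fs1 : HasCompactSupport fun s => s * f s := fs.mul_left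
  have fs2 : HasCompactSupport fun s => s ^ 2 * f s := fs.mul_left
  have gs1 : HasCompactSupport fun s => s * g s := gs.mul_left
  have gs2 : HasCompactSupport fun s => s ^ 2 * g s := gs.mul_left
  have icv : ∀ {a b : ℝ → ℝ}, Continuous a → HasCompactSupport a → Continuous b →
      HasCompactSupport b → Integrable (_root_.conv a b) := fun ha ha' hb hb' =>
    int (continuous_conv ha ha' hb) (hasCompactSupport_conv ha' hb')
  refine ⟨continuous_conv fc fs gc, hasCompactSupport_conv fs gs,
    fun t => integral_nonneg fun s => mul_nonneg (f0 _) (g0 _), ?_, ?_, ?_⟩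
  · rw [integral_conv (int fc fs) (int gc gs), f1, g1, one_mul]
  · simp_rw [mul_conv fc gc gs]
    rw [integral_add (icv fc1 fs1 gc gs) (icv fc fs gc1 gs1),
      integral_conv (int fc1 fs1) (int gc gs), integral_conv (int fc fs) (int gc1 gs1), fm, gm]
    simp
  · simp_rw [sq_mul_conv fc gc gs]
    have h2 : Integrable fun t => _root_.conv (fun s => s ^ 2 * f s) g t
        + 2 * _root_.conv (fun s => s * f s) (fun s => s * g s) t :=
      (icv fc2 fs2 gc gs).add ((icv fc1 fs1 gc1 gs1).const_mul 2)
    rw [integral_add h2 (icv fc fs gc2 gs2),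
      integral_add (icv fc2 fs2 gc gs) ((icv fc1 fs1 gc1 gs1).const_mul 2), integral_const_mul,
      integral_conv (int fc2 fs2) (int gc gs), integral_conv (int fc1 fs1) (int gc1 gs1),
      integral_conv (int fc fs) (int gc2 gs2), f1, g1, fm, fv, gv]
    ring

theorem IsCentredDensity.iterConv {f : ℝ → ℝ} {v : ℝ} (hf : IsCentredDensity f v) (n : ℕ) :
    IsCentredDensity (iterConv f n) ((n + 1) * v) := by
  induction n with
  | zero => simpa using! hf
  | succ n ih =>
    have h := hf.conv ih
    rw [show v + (n + 1) * v = ((n + 1 : ℕ) + 1) * v by push_cast; ring] at h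
    exact h

theorem IsCentredDensity.rescale {f : ℝ → ℝ} {v : ℝ} (hf : IsCentredDensity f v) {c : ℝ}
    (hc : 0 < c) : IsCentredDensity (fun t => c * f (c * t)) (v / c ^ 2) := by
  obtain ⟨fc, fs, f0, f1, fm, fv⟩ := hf
  have hc' : |c⁻¹| = c⁻¹ := abs_of_pos (inv_pos.2 hc)
  refine ⟨by fun_prop, ?_, fun t => mul_nonneg hc.le (f0 _), ?_, ?_, ?_⟩
  · exact (fs.comp_homeomorph (Homeomorph.mulLeft₀ c hc.ne')).mul_left
  · rw [integral_const_mul, Measure.integral_comp_mul_left, f1, hc', smul_eq_mul]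
    field_simp
  · have h := Measure.integral_comp_mul_left (fun s => s * f s) c
    rw [fm, smul_zero] at h
    refine Eq.trans ?_ h
    congr with t
    ring
  · have h := Measure.integral_comp_mul_left (fun s => s ^ 2 * f s) c
    rw [fv, hc', smul_eq_mul] at h
    rw [show v / c ^ 2 = c⁻¹ * (c⁻¹ * v) by field_simp, ← h, ← integral_const_mul]
    congr with t
    field_simp

theorem psi_eq_cos_max_min (t : ℝ) : psi t = (1 + cos (π * max (-1) (min 1 t))) / 2 := by
  unfold psi
  split_ifs with h
  · rw [abs_le] at h
    rw [min_eq_right h.2, max_eq_right h.1]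
  · rcases lt_abs.1 (not_le.1 h) with h | h
    · rw [min_eq_left h.le, max_eq_right (by norm_num)]
      simp
    · rw [min_eq_right (by linarith), max_eq_left (by linarith)]
      simp

theorem psi_eq_zero {t : ℝ} (ht : 1 < |t|) : psi t = 0 := if_neg ht.not_ge

theorem continuous_psi : Continuous psi := by
  rw [funext psi_eq_cos_max_min]
  fun_prop

theorem abs_psi_sub_psi_le (s t : ℝ) : |psi s - psi t| ≤ 2 * |s - t| := by
  have h1 := abs_cos_sub_cos_le (π * max (-1) (min 1 s)) (π * max (-1) (min 1 t))
  have h2 : |max (-1) (min 1 s) - max (-1) (min 1 t)| ≤ |s - t| := by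
    have := abs_max_sub_max_le_max (-1) (min 1 s) (-1) (min 1 t)
    have := abs_min_sub_min_le_max 1 s 1 t
    simp only [sub_self, abs_zero, abs_nonneg, sup_of_le_right] at *
    linarith
  rw [← mul_sub, abs_mul, abs_of_pos pi_pos] at h1
  have h3 : π * |max (-1) (min 1 s) - max (-1) (min 1 t)| ≤ 4 * |s - t| :=
    mul_le_mul pi_le_four h2 (abs_nonneg _) (by norm_num)
  rw [psi_eq_cos_max_min, psi_eq_cos_max_min, ← sub_div, add_sub_add_left_eq_sub, abs_div, abs_two]
  linarith

theorem isCentredDensity_psi : IsCentredDensity psi (∫ t, t ^ 2 * psi t) := by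
  refine ⟨continuous_psi, ?_, fun t => ?_, integral_psi, ?_, rfl⟩
  · refine HasCompactSupport.intro (isCompact_Icc (a := (-1 : ℝ)) (b := 1)) fun t ht => ?_
    exact psi_eq_zero (not_le.1 fun h => ht (abs_le.1 h))
  · rw [psi_eq_cos_max_min]
    linarith [neg_one_le_cos (π * max (-1) (min 1 t))]
  · have h := integral_neg_eq_self (fun t => t * psi t) volume
    have h' : ∀ t, psi (-t) = psi t := fun t => by simp [psi]
    simp only [h', neg_mul, integral_neg] at h
    linarith

theorem isCentredDensity_thetak {lam : ℝ} (hlam : 0 < lam) {k : ℕ} (hk : 1 ≤ k) :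
    IsCentredDensity (thetak lam k) ((∫ t, t ^ 2 * psi t) / (4 * lam⁻¹) ^ 2 / k) := by
  have hk' : (0 : ℝ) < k := by exact_mod_cast hk
  have h := ((isCentredDensity_psi.rescale (c := 4 * lam⁻¹) (by positivity)).rescale hk').iterConv
    (k - 1)
  rw [Nat.cast_sub hk, Nat.cast_one, sub_add_cancel] at h
  rw [show (∫ t, t ^ 2 * psi t) / (4 * lam⁻¹) ^ 2 / k =
    k * ((∫ t, t ^ 2 * psi t) / (4 * lam⁻¹) ^ 2 / (k : ℝ) ^ 2) by field_simp]
  exact h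

theorem phimu_eq (lam μ t : ℝ) :
    phimu lam μ t = μ⁻¹ * (4 * lam⁻¹) * psi (4 * lam⁻¹ * (μ⁻¹ * t)) := by
  unfold phimu theta
  ring

theorem continuous_phimu (lam μ : ℝ) : Continuous (phimu lam μ) := by
  rw [funext (phimu_eq lam μ)]
  have := continuous_psi
  fun_prop

theorem phimu_eq_zero {lam μ t : ℝ} (hlam : 0 < lam) (hμ : 0 < μ) (ht : lam * μ / 4 < |t|) :
    phimu lam μ t = 0 := by
  rw [phimu_eq, psi_eq_zero, mul_zero]
  rw [abs_mul (4 * lam⁻¹), abs_mul μ⁻¹, abs_of_pos (by positivity : 0 < 4 * lam⁻¹),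
    abs_of_pos (inv_pos.2 hμ)]
  field_simp
  linarith

theorem abs_phimu_sub_phimu_le {lam μ : ℝ} (hlam : 0 < lam) (hμ : 0 < μ) (s t : ℝ) :
    |phimu lam μ s - phimu lam μ t| ≤ 32 / (lam * μ) ^ 2 * |s - t| := by
  have h := abs_psi_sub_psi_le (4 * lam⁻¹ * (μ⁻¹ * s)) (4 * lam⁻¹ * (μ⁻¹ * t))
  have hc : 0 < 4 * lam⁻¹ := by positivity
  have hc' : 0 < μ⁻¹ := by positivity
  rw [← mul_sub, ← mul_sub, abs_mul (4 * lam⁻¹), abs_mul μ⁻¹, abs_of_pos hc, abs_of_pos hc'] at h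
  rw [phimu_eq, phimu_eq, ← mul_sub, abs_mul, abs_of_pos (by positivity)]
  refine (mul_le_mul_of_nonneg_left h (by positivity)).trans (le_of_eq ?_)
  field_simp
  ring

/-- The `L²` modulus of continuity of a compactly supported Lipschitz function. -/
theorem integral_sq_sub_translate_le {φ : ℝ → ℝ} {L R : ℝ} (hR : 0 ≤ R)
    (hL : ∀ s t, |φ s - φ t| ≤ L * |s - t|) (hφ : ∀ t, R < |t| → φ t = 0) (s : ℝ) :
    ∫ t, (φ t - φ (t - s)) ^ 2 ≤ 4 * R * L ^ 2 * s ^ 2 := by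
  have hi : ∀ a : ℝ, Integrable
      ((Set.Icc (a - R) (a + R)).indicator fun _ => L ^ 2 * s ^ 2) := fun a =>
    (integrable_indicator_iff measurableSet_Icc).2 continuous_const.integrableOn_Icc
  have hv : ∀ a : ℝ, ∫ t, (Set.Icc (a - R) (a + R)).indicator (fun _ => L ^ 2 * s ^ 2) t
      = 2 * R * (L ^ 2 * s ^ 2) := fun a => by
    rw [integral_indicator_const _ measurableSet_Icc, Real.volume_real_Icc_of_le (by linarith),
      smul_eq_mul]
    ring
  calc ∫ t, (φ t - φ (t - s)) ^ 2
      ≤ ∫ t, ((Set.Icc (0 - R) (0 + R)).indicator (fun _ => L ^ 2 * s ^ 2) t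
          + (Set.Icc (s - R) (s + R)).indicator (fun _ => L ^ 2 * s ^ 2) t) := by
        refine integral_mono_of_nonneg (Eventually.of_forall fun t => sq_nonneg _)
          ((hi 0).add (hi s)) (Eventually.of_forall fun t => ?_)
        have hb : (φ t - φ (t - s)) ^ 2 ≤ L ^ 2 * s ^ 2 := by
          have h := hL t (t - s)
          rw [sub_sub_cancel] at h
          calc (φ t - φ (t - s)) ^ 2 = |φ t - φ (t - s)| ^ 2 := (sq_abs _).symm
            _ ≤ (L * |s|) ^ 2 := pow_le_pow_left₀ (abs_nonneg _) h 2
            _ = L ^ 2 * s ^ 2 := by rw [mul_pow, sq_abs]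
        have h0 : 0 ≤ L ^ 2 * s ^ 2 := by positivity
        simp only [Set.indicator_apply]
        split_ifs with h1 h2 h2
        · linarith
        · linarith
        · linarith
        · rw [hφ t, hφ (t - s)]
          · simp
          · exact not_le.1 fun h => h2 (by rw [abs_le] at h; constructor <;> linarith)
          · exact not_le.1 fun h => h1 (by rw [abs_le] at h; constructor <;> linarith)
    _ = 4 * R * L ^ 2 * s ^ 2 := by
        rw [integral_add (hi 0) (hi s), hv, hv]
        ring

/-- Jensen's inequality for the deviation of a function from its smoothing by a density. -/
theorem IsCentredDensity.sq_sub_conv_le {f φ : ℝ → ℝ} {v : ℝ} (hf : IsCentredDensity f v)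
    (hφ : Continuous φ) (t : ℝ) :
    (φ t - _root_.conv f φ t) ^ 2 ≤ ∫ s, f s * (φ t - φ (t - s)) ^ 2 := by
  obtain ⟨fc, fs, f0, f1, -, -⟩ := hf
  have hc : _root_.conv f φ t = ∫ s, f s * φ (t - s) := by
    rw [conv_eq_convolution]; rfl
  have int : ∀ {h : ℝ → ℝ}, Continuous h → Integrable fun s => f s * h s := fun hh =>
    (fc.mul hh).integrable_of_hasCompactSupport fs.mul_right
  set m := φ t - _root_.conv f φ t with hm
  have hmean : ∫ s, f s * (φ t - φ (t - s)) = m := by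
    simp_rw [mul_sub]
    rw [integral_sub (int continuous_const) (int (by fun_prop)), integral_mul_const, f1, one_mul,
      hm, hc]
  have h0 : 0 ≤ ∫ s, f s * ((φ t - φ (t - s)) - m) ^ 2 :=
    integral_nonneg fun s => mul_nonneg (f0 s) (sq_nonneg _)
  have h1 : ∀ s, f s * ((φ t - φ (t - s)) - m) ^ 2 =
      f s * (φ t - φ (t - s)) ^ 2 - (f s * (φ t - φ (t - s)) * (2 * m) - f s * m ^ 2) :=
    fun s => by ring
  simp_rw [h1] at h0
  have i1 := int (by fun_prop : Continuous fun s => φ t - φ (t - s))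
  have i2 := int (continuous_const : Continuous fun _ : ℝ => m ^ 2)
  have i3 : Integrable fun s => f s * (φ t - φ (t - s)) * (2 * m) - f s * m ^ 2 :=
    (i1.mul_const _).sub i2
  rw [integral_sub (int (by fun_prop)) i3,
    integral_sub (i1.mul_const _) i2, integral_mul_const, integral_mul_const, hmean, f1] at h0
  linarith

theorem IsCentredDensity.integral_sq_sub_conv_le {f φ : ℝ → ℝ} {v L R : ℝ}
    (hf : IsCentredDensity f v) (hφ : Continuous φ) (hR : 0 ≤ R)
    (hL : ∀ s t, |φ s - φ t| ≤ L * |s - t|) (hφR : ∀ t, R < |t| → φ t = 0) :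
    ∫ t, (φ t - _root_.conv f φ t) ^ 2 ≤ 4 * R * L ^ 2 * v := by
  have fc := hf.continuous
  have hint : Integrable (Function.uncurry fun t s => f s * (φ t - φ (t - s)) ^ 2)
      (volume.prod volume) := by
    refine Continuous.integrable_of_hasCompactSupport
      (by simp only [Function.uncurry_def]; fun_prop) ?_
    have hK := hf.hasCompactSupport.isCompact
    have hI := isCompact_Icc (a := -R) (b := R)
    refine HasCompactSupport.intro ((hI.union (hI.add hK)).prod hK) ?_
    rintro ⟨t, s⟩ hts
    simp only [Function.uncurry_apply_pair]
    by_cases hs : s ∈ tsupport f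
    · have hmem : ∀ x, x ∉ Set.Icc (-R) R → φ x = 0 := fun x hx =>
        hφR x (not_le.1 fun h => hx (abs_le.1 h))
      rw [hmem t fun h => hts ⟨Or.inl h, hs⟩, hmem (t - s) fun h =>
        hts ⟨Or.inr (Set.mem_add.2 ⟨t - s, h, s, hs, sub_add_cancel t s⟩), hs⟩]
      simp
    · rw [image_eq_zero_of_notMem_tsupport hs, zero_mul]
  calc ∫ t, (φ t - _root_.conv f φ t) ^ 2
      ≤ ∫ t, ∫ s, f s * (φ t - φ (t - s)) ^ 2 :=
        integral_mono_of_nonneg (Eventually.of_forall fun t => sq_nonneg _)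
          hint.integral_prod_left (Eventually.of_forall fun t => hf.sq_sub_conv_le hφ t)
    _ = ∫ s, ∫ t, f s * (φ t - φ (t - s)) ^ 2 := integral_integral_swap hint
    _ ≤ ∫ s, 4 * R * L ^ 2 * (s ^ 2 * f s) := by
        refine integral_mono hint.integral_prod_right
          (((by fun_prop : Continuous fun s => s ^ 2 * f s).integrable_of_hasCompactSupport
            hf.hasCompactSupport.mul_left).const_mul _) fun s => ?_
        simp only
        rw [integral_const_mul]
        have h := mul_le_mul_of_nonneg_left (integral_sq_sub_translate_le hR hL hφR s)
          (hf.nonneg s)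
        linarith
    _ = 4 * R * L ^ 2 * v := by rw [integral_const_mul, hf.integral_sq_mul_eq]

theorem one_div_cube_mul_le_rpow {μ κ : ℝ} (hμ : 0 < μ) (hκ : 1 ≤ κ)
    (h : 1 ≤ μ ^ 2 * κ ^ ((3 : ℝ) / 5)) :
    1 / (μ ^ 3 * κ) ≤ ((κ ^ ((3 : ℝ) / 5) * μ ^ 2) ^ (-(5 : ℝ) / 8)) ^ 2 := by
  have hκ0 : 0 < κ := by linarith
  rw [mul_comm] at h
  have hx : 0 < κ ^ ((3 : ℝ) / 5) * μ ^ 2 := by positivity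
  calc 1 / (μ ^ 3 * κ) ≤ 1 / ((κ ^ ((3 : ℝ) / 5) * μ ^ 2) ^ ((3 : ℝ) / 2)) := by
        refine one_div_le_one_div_of_le (by positivity) ?_
        rw [mul_rpow (by positivity) (by positivity), ← rpow_mul hκ0.le, ← rpow_natCast μ 2,
          ← rpow_mul hμ.le, mul_comm]
        norm_num
        gcongr
        calc κ ^ ((9 : ℝ) / 10) ≤ κ ^ (1 : ℝ) := rpow_le_rpow_of_exponent_le hκ (by norm_num)
          _ = κ := rpow_one κ
    _ = (κ ^ ((3 : ℝ) / 5) * μ ^ 2) ^ (-(3 : ℝ) / 2) := by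
        rw [neg_div, rpow_neg hx.le, one_div]
    _ ≤ (κ ^ ((3 : ℝ) / 5) * μ ^ 2) ^ (-(5 : ℝ) / 8 * (2 : ℕ)) :=
        rpow_le_rpow_of_exponent_le h (by norm_num)
    _ = _ := by rw [rpow_mul hx.le, rpow_natCast]

/-- **L² estimate for `φ_μ − φ_{μ,k}`:** if `μ²k^{3/5} ≥ 1` then
`‖φ_μ − φ_{μ,k}‖_{L²(ℝ)} ≤ C (k^{3/5} μ²)^{-5/8}` with `C = C(λ)`. -/
theorem phimu_phimuk_L2_estimate :
    ∀ lam : ℝ, lam ∈ Set.Ioc (0:ℝ) 1 →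
    ∃ C : ℝ, 0 < C ∧
    ∀ μ : ℝ, μ ∈ Set.Ioc (0:ℝ) 1 →
    ∀ k : ℕ, 1 ≤ k → 1 ≤ μ^2 * (k : ℝ) ^ ((3:ℝ)/5) →
      Real.sqrt (∫ t : ℝ, (phimu lam μ t - phimuk lam μ k t)^2) ≤
        C * ((k : ℝ) ^ ((3:ℝ)/5) * μ^2) ^ (-(5:ℝ)/8) := by
  intro lam hlam
  have hlam0 : 0 < lam := hlam.1
  set M := ∫ t, t ^ 2 * psi t with hM
  have hM0 : 0 ≤ M := integral_nonneg fun t =>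
    mul_nonneg (sq_nonneg t) (isCentredDensity_psi.nonneg t)
  refine ⟨Real.sqrt (64 * M / lam) + 1, by positivity, fun μ hμ k hk h => ?_⟩
  have hμ0 : 0 < μ := hμ.1
  have hk1 : (1 : ℝ) ≤ k := by exact_mod_cast hk
  have hk0 : (0 : ℝ) < k := by linarith
  set y := ((k : ℝ) ^ ((3:ℝ)/5) * μ^2) ^ (-(5:ℝ)/8) with hy
  have hy0 : 0 ≤ y := by positivity
  have hI := (isCentredDensity_thetak hlam0 hk).integral_sq_sub_conv_le (continuous_phimu lam μ)
    (by positivity : 0 ≤ lam * μ / 4) (abs_phimu_sub_phimu_le hlam0 hμ0)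
    (fun t ht => phimu_eq_zero hlam0 hμ0 ht)
  have hI' : ∫ t : ℝ, (phimu lam μ t - phimuk lam μ k t)^2 ≤ 64 * M / lam * y ^ 2 := by
    refine hI.trans ?_
    rw [← hM]
    have hle := mul_le_mul_of_nonneg_left (one_div_cube_mul_le_rpow hμ0 hk1 h)
      (by positivity : 0 ≤ 64 * M / lam)
    refine le_trans (le_of_eq ?_) hle
    field_simp
    ring
  calc Real.sqrt (∫ t : ℝ, (phimu lam μ t - phimuk lam μ k t)^2)
      ≤ Real.sqrt (64 * M / lam * y ^ 2) := Real.sqrt_le_sqrt hI'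
    _ = Real.sqrt (64 * M / lam) * y := by
        rw [Real.sqrt_mul (by positivity), Real.sqrt_sq hy0]
    _ ≤ (Real.sqrt (64 * M / lam) + 1) * y := by
        gcongr
        linarith
end
end
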